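/- arXiv:0912.1414 — 2 statements merged into one kernel-verified Lean document; each statement's English description precedes it below -/
import Mathlib

section
/- For every multiplicative character χ of order 231 of the finite field F_q with q = 53^30, the Gauss sum G(χ) = Σ_{x ∈ F_q} χ(x) ψ(x) ∈ ℂ equals 53^15. -/
namespace StickelbergerUnit

open Finset

section Residue

variable {F : Type*} [Field F] [Fintype F] {K : Type*} [Field K]

theorem sum_eq_sum_units [DecidableEq F] {M : Type*} [AddCommMonoid M] {f : F → M}
    (h0 : f 0 = 0) : ∑ x, f x = ∑ u : Fˣ, f u := by
  rw [Fintype.sum_eq_add_sum_compl 0, h0, zero_add]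
  refine (Finset.sum_bij (fun (u : Fˣ) _ => (u : F)) ?_ ?_ ?_ ?_).symm
  · intro u _; simp
  · intro a _ b _ h; exact Units.ext h
  · intro b hb
    exact ⟨Units.mk0 b (by simpa using hb), mem_univ _, rfl⟩
  · intro u _; rfl

theorem sum_pow_eq_ite (i : ℕ) (hi : 0 < i) :
    ∑ x : F, x ^ i = if Fintype.card F - 1 ∣ i then -1 else 0 := by
  classical
  rw [← FiniteField.sum_pow_units F i, sum_eq_sum_units (zero_pow hi.ne')]

/-- The Jacobi sum congruence modulo a prime above the characteristic, as an identity in `F`. -/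
theorem sum_pow_mul_one_sub_pow (hq : 2 < Fintype.card F) {n : ℕ} (hn : n ≤ Fintype.card F - 1) :
    ∑ y : F, y ^ (Fintype.card F - 2) * (1 - y) ^ n = n := by
  set q := Fintype.card F with hqd
  have expand : ∀ y : F, y ^ (q - 2) * (1 - y) ^ n =
      ∑ j ∈ range (n + 1), (-1) ^ j * (n.choose j : F) * y ^ (q - 2 + j) := by
    intro y
    rw [sub_eq_neg_add, add_pow, Finset.mul_sum]
    refine sum_congr rfl fun j _ => ?_
    rw [neg_pow, pow_add]; ring
  simp_rw [expand]
  rw [sum_comm]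
  simp_rw [← Finset.mul_sum]
  rw [sum_eq_single 1]
  · rw [sum_pow_eq_ite _ (by omega), if_pos ⟨1, by omega⟩]
    simp
  · intro j hj hj1
    rw [sum_pow_eq_ite _ (by omega), if_neg, mul_zero]
    rintro ⟨c, hc⟩
    rw [← hqd] at hc
    have hj' : j ≤ n := by simpa [Nat.lt_succ_iff] using hj
    have h1 : c < 2 := by
      by_contra! h
      have : (q - 1) * 2 ≤ (q - 1) * c := Nat.mul_le_mul_left _ h
      omega
    interval_cases c <;> omega
  · intro h
    have : n = 0 := by simpa using h
    simp [this]

variable {R : Type*} [CommRing R] (ρ : R →+* K) (σ : F →+* K) {ω : MulChar F R}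

theorem map_inv_pow_apply (hω : ∀ x, ρ (ω x) = σ x) {k : ℕ} (hk : k < Fintype.card F - 1)
    (x : F) :
    ρ ((ω⁻¹ ^ k) x) = σ x ^ (Fintype.card F - 1 - k) := by
  rcases eq_or_ne x 0 with rfl | hx
  · rw [MulChar.map_nonunit _ (by simp)]
    simp [Nat.sub_ne_zero_of_lt hk]
  · have h1 : σ x ^ k ≠ 0 := pow_ne_zero _ (by simpa using hx)
    obtain ⟨u, rfl⟩ := hx.isUnit
    apply mul_left_cancel₀ h1
    rw [← pow_add, Nat.add_sub_cancel' hk.le, ← map_pow, ← map_pow σ,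
      FiniteField.pow_card_sub_one_eq_one _ hx, map_pow, map_one, ← hω, ← map_pow, ← map_mul]
    rw [← MulChar.pow_apply_coe, ← MulChar.mul_apply, ← mul_pow, mul_inv_cancel, one_pow,
      MulChar.one_apply_coe, map_one]

theorem map_jacobiSum_inv_pow (hω : ∀ x, ρ (ω x) = σ x) {k : ℕ} (hk : k + 1 < Fintype.card F - 1) :
    ρ (jacobiSum (ω⁻¹ ^ k) ω⁻¹) = -((k + 1 : ℕ) : K) := by
  have hinv : ∀ x, ρ (ω⁻¹ x) = σ x ^ (Fintype.card F - 2) := fun x => by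
    have := map_inv_pow_apply ρ σ hω (k := 1) (by omega) x
    rwa [pow_one, Nat.sub_sub] at this
  rw [jacobiSum_comm, jacobiSum, map_sum]
  simp_rw [map_mul, hinv, map_inv_pow_apply ρ σ hω (show k < Fintype.card F - 1 by omega)]
  have := congrArg σ (sum_pow_mul_one_sub_pow (F := F) (by omega)
    (n := Fintype.card F - 1 - k) (by omega))
  rw [map_sum] at this
  simp_rw [map_mul, map_pow] at this
  rw [this, map_natCast, eq_neg_iff_add_eq_zero, ← Nat.cast_add]
  have h2 : Fintype.card F - 1 - k + (k + 1) = Fintype.card F := by omega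
  rw [h2, ← map_natCast σ, FiniteField.cast_card_eq_zero, map_zero]

theorem inv_pow_ne_one (hω : ∀ x, ρ (ω x) = σ x) {k : ℕ} (hk0 : 0 < k)
    (hk : k < Fintype.card F - 1) :
    ω⁻¹ ^ k ≠ 1 := by
  intro h
  have : Fintype.card F - 1 ∣ Fintype.card F - 1 - k := by
    rw [← FiniteField.forall_pow_eq_one_iff]
    intro x
    have := map_inv_pow_apply ρ σ hω hk x
    rw [h, MulChar.one_apply_coe, map_one, ← map_pow, eq_comm, map_eq_one_iff σ σ.injective] at this
    exact Units.ext (by simpa using this)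
  have := Nat.le_of_dvd (by omega) this
  omega

theorem gaussSum_pow_char {p : ℕ} [Fact p.Prime] [CharP F p] (χ : MulChar F R) {ψ : AddChar F R}
    (hψ : ∀ x, ψ (x ^ p) = ψ x) : gaussSum (χ ^ p) ψ = gaussSum χ ψ := by
  have hp : p ≠ 0 := (Fact.out : p.Prime).ne_zero
  unfold gaussSum
  refine Fintype.sum_bijective (frobenius F p) (bijective_frobenius F p) _ _ fun x => ?_
  rw [frobenius_def, hψ, map_pow, MulChar.pow_apply' _ hp]

/-- Stickelberger's factorisation of Gauss sums, up to units modulo the kernel of `ρ`. -/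
theorem exists_mul_gaussSum_inv_pow_eq [IsDomain R] {p : ℕ} [Fact p.Prime] [CharP F p]
    (hω : ∀ x, ρ (ω x) = σ x) {ψ : AddChar F R} (hψ1 : ψ ≠ 1) (hψ : ∀ x, ψ (x ^ p) = ψ x)
    (k : ℕ) (hk : k < Fintype.card F - 1) :
    ∃ u v : R, ρ u ≠ 0 ∧ ρ v ≠ 0 ∧
      u * gaussSum (ω⁻¹ ^ k) ψ = v * gaussSum ω⁻¹ ψ ^ (p.digits k).sum := by
  have hp : p.Prime := Fact.out
  have : CharP K p := charP_of_injective_ringHom σ.injective p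
  induction k using Nat.strong_induction_on with
  | _ k ih =>
  rcases Nat.eq_zero_or_pos k with rfl | hk0
  · exact ⟨-1, 1, by simp, by simp, by simp [gaussSum_one_left hψ1]⟩
  have hdig := Nat.digits_eq_cons_digits_div hp.one_lt hk0.ne'
  by_cases hpk : p ∣ k
  · obtain ⟨m, rfl⟩ := hpk
    have hm0 : 0 < m := Nat.pos_of_mul_pos_left hk0
    have hm : m < p * m := lt_mul_of_one_lt_left hm0 hp.one_lt
    obtain ⟨u, v, hu, hv, h⟩ := ih m hm (hm.trans hk)
    refine ⟨u, v, hu, hv, ?_⟩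
    rw [Nat.digits_base_mul hp.one_lt hm0, List.sum_cons, zero_add, ← h, mul_comm p m, pow_mul,
      gaussSum_pow_char _ hψ]
  · obtain ⟨u, v, hu, hv, h⟩ := ih (k - 1) (by omega) (by omega)
    have hJ := map_jacobiSum_inv_pow ρ σ hω (k := k - 1) (by omega)
    rw [Nat.sub_add_cancel hk0] at hJ
    refine ⟨u * jacobiSum (ω⁻¹ ^ (k - 1)) ω⁻¹, v, ?_, hv, ?_⟩
    · rw [map_mul, hJ]
      refine mul_ne_zero hu (neg_ne_zero.2 ?_)
      rwa [Ne, CharP.cast_eq_zero_iff K p]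
    · have hne := inv_pow_ne_one ρ σ hω hk0 hk
      have hmul : ω⁻¹ ^ k = ω⁻¹ ^ (k - 1) * ω⁻¹ := by rw [← pow_succ, Nat.sub_add_cancel hk0]
      have hs : (p.digits k).sum = (p.digits (k - 1)).sum + 1 := by
        have hmod : k % p ≠ 0 := fun h => hpk (Nat.dvd_of_mod_eq_zero h)
        have hlt := Nat.mod_lt k hp.pos
        have hk' : k - 1 = (k % p - 1) + p * (k / p) := by
          have := Nat.mod_add_div k p; omega
        have e1 : (k - 1) % p = k % p - 1 := by
          rw [hk', Nat.add_mul_mod_self_left, Nat.mod_eq_of_lt (by omega)]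
        have e2 : (k - 1) / p = k / p := by
          rw [hk', Nat.add_mul_div_left _ _ hp.pos, Nat.div_eq_of_lt (by omega), zero_add]
        rw [hdig, List.sum_cons]
        rcases Nat.eq_zero_or_pos (k - 1) with h0 | h0
        · have hk1 : k = 1 := by omega
          subst hk1
          simp [Nat.mod_eq_of_lt hp.one_lt, Nat.div_eq_of_lt hp.one_lt]
        · rw [Nat.digits_eq_cons_digits_div hp.one_lt h0.ne', List.sum_cons, e1, e2]
          omega
      rw [hs, pow_succ, ← mul_assoc v, ← h, hmul, mul_assoc, mul_comm (jacobiSum _ _),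
        jacobiSum_mul_nontrivial (hmul ▸ hne), mul_assoc]

end Residue

/-- The ring of all algebraic integers in `ℂ`. -/
abbrev AlgInt : Type := integralClosure ℤ ℂ

theorem exists_algInt_root {f : Polynomial AlgInt} (hf : f.Monic) (hd : f.natDegree ≠ 0) :
    ∃ x, f.eval x = 0 := by
  have hinj : Function.Injective (algebraMap AlgInt ℂ) := Subtype.val_injective
  obtain ⟨z, hz⟩ := IsAlgClosed.exists_root (f.map (algebraMap AlgInt ℂ)) (by
    rw [Polynomial.degree_map_eq_of_injective hinj]
    intro h
    exact hd (Polynomial.natDegree_eq_of_degree_eq_some h))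
  have hint : IsIntegral AlgInt z := ⟨f, hf, by
    rwa [Polynomial.IsRoot, Polynomial.eval_map] at hz⟩
  have hz' : IsIntegral ℤ z := isIntegral_trans z hint
  refine ⟨⟨z, hz'⟩, hinj ?_⟩
  rw [map_zero, ← hz, Polynomial.eval_map]
  exact (Polynomial.eval₂_at_apply (algebraMap AlgInt ℂ) (⟨z, hz'⟩ : AlgInt)).symm

theorem isAlgClosed_quotient (P : Ideal AlgInt) [hP : P.IsMaximal] :
    letI := Ideal.Quotient.field P
    IsAlgClosed (AlgInt ⧸ P) := by
  let := Ideal.Quotient.field P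
  refine IsAlgClosed.of_exists_root _ fun f hf hirr => ?_
  obtain ⟨g, hg, hdeg, hgm⟩ := Polynomial.lifts_and_natDegree_eq_and_monic
    (f := Ideal.Quotient.mk P) (Polynomial.map_surjective _ Ideal.Quotient.mk_surjective f) hf
  obtain ⟨x, hx⟩ := exists_algInt_root hgm (by rw [hdeg]; exact hirr.natDegree_pos.ne')
  refine ⟨Ideal.Quotient.mk P x, ?_⟩
  rw [← hg, Polynomial.eval_map, Polynomial.eval₂_at_apply, hx, map_zero]

theorem exists_primitiveRoot {n : ℕ} (hn : 0 < n) : ∃ ζ : AlgInt, IsPrimitiveRoot ζ n := by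
  have h := Complex.isPrimitiveRoot_exp n hn.ne'
  refine ⟨⟨_, h.isIntegral hn⟩, ?_⟩
  exact IsPrimitiveRoot.of_map_of_injective (f := algebraMap AlgInt ℂ) h Subtype.val_injective

section Unit

variable {F : Type*} [Field F] [Fintype F] {p : ℕ} [Fact p.Prime]

theorem nonempty_ringHom_of_isAlgClosed [CharP F p] {K : Type*} [Field K] [IsAlgClosed K]
    [CharP K p] : Nonempty (F →+* K) := by
  let := ZMod.algebra F p
  let := ZMod.algebra K p
  exact ⟨(IsAlgClosed.lift : F →ₐ[ZMod p] K).toRingHom⟩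

/-- The Teichmüller character attached to an embedding of `F` in a residue field of `AlgInt`. -/
theorem exists_teichmuller {K : Type*} [Field K] (ρ : AlgInt →+* K) (σ : F →+* K) :
    ∃ ω : MulChar F AlgInt, ∀ x, ρ (ω x) = σ x := by
  classical
  obtain ⟨g, hg⟩ := IsCyclic.exists_generator (α := Fˣ)
  set n := Fintype.card Fˣ with hn
  have hn0 : 0 < n := Fintype.card_pos
  obtain ⟨ζ, hζ⟩ := exists_primitiveRoot hn0
  have hnK : (n : K) ≠ 0 := by
    rw [hn, Fintype.card_units, Nat.cast_sub Fintype.card_pos, ← map_natCast σ,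
      FiniteField.cast_card_eq_zero]
    simp
  have hζ' : IsPrimitiveRoot (ρ ζ) n := by
    have : NeZero (n : K) := ⟨hnK⟩
    rw [← Polynomial.isRoot_cyclotomic_iff, ← Polynomial.map_cyclotomic n ρ, Polynomial.IsRoot,
      Polynomial.eval_map, Polynomial.eval₂_at_apply]
    have := hζ.isRoot_cyclotomic hn0
    rw [this, map_zero]
  have : NeZero n := ⟨hn0.ne'⟩
  obtain ⟨i, -, hi⟩ := hζ'.eq_pow_of_pow_eq_one (ξ := σ g) (by
    rw [← map_pow, ← Units.val_pow_eq_pow_val, hn, pow_card_eq_one, Units.val_one, map_one])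
  have hu : (hζ.isUnit hn0.ne').unit ^ i ∈ rootsOfUnity (Fintype.card Fˣ) AlgInt := by
    rw [mem_rootsOfUnity, ← pow_mul, mul_comm, pow_mul]
    have : (hζ.isUnit hn0.ne').unit ^ n = 1 := Units.ext (by simpa using hζ.pow_eq_one)
    rw [← hn, this, one_pow]
  refine ⟨MulChar.ofRootOfUnity hu hg, fun x => ?_⟩
  have hspec := MulChar.ofRootOfUnity_spec hu hg
  rcases eq_or_ne x 0 with rfl | hx
  · rw [MulChar.map_nonunit _ (by simp), map_zero, map_zero]
  · obtain ⟨k, hk : g ^ k = Units.mk0 x hx⟩ := mem_powers_iff_mem_zpowers.2 (hg (Units.mk0 x hx))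
    have hx' : x = (g : F) ^ k := by
      rw [← Units.val_pow_eq_pow_val, hk, Units.val_mk0]
    rw [hx', map_pow, hspec, map_pow, map_pow, ← hi]
    simp

theorem eq_inv_pow_of_teichmuller {K : Type*} [Field K] {ρ : AlgInt →+* K} {σ : F →+* K}
    {ω : MulChar F AlgInt} (hω : ∀ x, ρ (ω x) = σ x) (χ : MulChar F AlgInt) :
    ∃ k < Fintype.card F - 1, χ = ω⁻¹ ^ k := by
  classical
  obtain ⟨g, hg⟩ := IsCyclic.exists_generator (α := Fˣ)
  have hcard : Fintype.card Fˣ = Fintype.card F - 1 := Fintype.card_units F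
  have hpos : 0 < Fintype.card F - 1 := hcard ▸ Fintype.card_pos
  have : NeZero (Fintype.card F - 1) := ⟨hpos.ne'⟩
  have hχ1 : ∀ φ : MulChar F AlgInt, φ g ^ (Fintype.card F - 1) = 1 := fun φ => by
    rw [← map_pow, FiniteField.pow_card_sub_one_eq_one _ g.ne_zero, map_one]
  have hprim : IsPrimitiveRoot (ω⁻¹ g) (Fintype.card F - 1) := by
    refine IsPrimitiveRoot.mk_of_lt _ hpos (hχ1 _) fun l hl hl' h => ?_
    refine inv_pow_ne_one ρ σ hω hl hl' ?_
    rw [MulChar.eq_iff hg, MulChar.pow_apply_coe, h, MulChar.one_apply_coe]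
  obtain ⟨k, hk, hk'⟩ := hprim.eq_pow_of_pow_eq_one (hχ1 χ)
  refine ⟨k, hk, ?_⟩
  rw [MulChar.eq_iff hg, MulChar.pow_apply_coe, hk']

/-- If the base-`p` digit sums attached to `χ` and `χ⁻¹` agree at every prime above `p`, then
`G(χ)` is divisible by `G(χ⁻¹)` in the ring of algebraic integers. -/
theorem gaussSum_inv_dvd_gaussSum [CharP F p] {ψ : AddChar F AlgInt} (hψ1 : ψ ≠ 1)
    (hψ : ∀ x, ψ (x ^ p) = ψ x) {χ : MulChar F AlgInt} (hχ1 : χ ≠ 1)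
    (hχm : χ (-1) = 1)
    (hdig : ∀ a < orderOf χ, a.Coprime (orderOf χ) →
      (p.digits (a * ((Fintype.card F - 1) / orderOf χ))).sum =
        (p.digits (Fintype.card F - 1 - a * ((Fintype.card F - 1) / orderOf χ))).sum) :
    gaussSum χ⁻¹ ψ ∣ gaussSum χ ψ := by
  have hNdvd := χ.orderOf_dvd_card_sub_one
  have hprod : gaussSum χ ψ * gaussSum χ⁻¹ ψ = Fintype.card F := by
    rw [← gaussSum_mul_gaussSum_eq_card hχ1 (AddChar.IsPrimitive.of_ne_one hψ1),
      ← mul_gaussSum_inv_eq_gaussSum χ⁻¹ ψ, MulChar.inv_apply', inv_neg_one, hχm, one_mul]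
  let I : Ideal AlgInt := (Ideal.span {gaussSum χ⁻¹ ψ}).colon {gaussSum χ ψ}
  have hI : ∀ r, r ∈ I ↔ gaussSum χ⁻¹ ψ ∣ r * gaussSum χ ψ := fun r => by
    rw [Submodule.mem_colon_singleton, Ideal.mem_span_singleton, smul_eq_mul]
  suffices h : I = ⊤ by
    have := (hI 1).1 (h ▸ Submodule.mem_top)
    rwa [one_mul] at this
  by_contra hne
  obtain ⟨P, hP, hIP⟩ := Ideal.exists_le_maximal I hne
  let := Ideal.Quotient.field P
  set ρ := Ideal.Quotient.mk P
  have hcardI : (Fintype.card F : AlgInt) ∈ I := (hI _).2 (by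
    rw [← hprod, mul_comm (gaussSum χ ψ), mul_assoc]; exact dvd_mul_right _ _)
  have hpK : (p : AlgInt ⧸ P) = 0 := by
    have h := Ideal.Quotient.eq_zero_iff_mem.2 (hIP hcardI)
    obtain ⟨n, -, hn⟩ := FiniteField.card F p
    rw [hn, map_natCast, Nat.cast_pow] at h
    exact eq_zero_of_pow_eq_zero h
  have : CharP (AlgInt ⧸ P) p := (CharP.charP_iff_prime_eq_zero Fact.out).2 hpK
  have := isAlgClosed_quotient P
  obtain ⟨σ⟩ := nonempty_ringHom_of_isAlgClosed (F := F) (p := p) (K := AlgInt ⧸ P)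
  obtain ⟨ω, hω⟩ := exists_teichmuller ρ σ
  obtain ⟨k, hk, hχk⟩ := eq_inv_pow_of_teichmuller hω χ
  have hone : (ω⁻¹) ^ (Fintype.card F - 1) = 1 := by
    classical rw [← Fintype.card_units, MulChar.pow_card_eq_one]
  have hinv : χ⁻¹ = ω⁻¹ ^ (Fintype.card F - 1 - k) := by
    rw [inv_eq_iff_mul_eq_one, hχk, ← pow_add, Nat.add_sub_cancel' hk.le, hone]
  have hk0 : 0 < k := Nat.pos_of_ne_zero fun h => hχ1 (by rw [hχk, h, pow_zero])
  have hord : orderOf ω⁻¹ = Fintype.card F - 1 :=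
    (orderOf_eq_iff (by omega)).2 ⟨hone, fun m hm hm0 => inv_pow_ne_one ρ σ hω hm0 hm⟩
  set N := orderOf χ with hN
  obtain ⟨c, hc⟩ := hNdvd
  have hN0 : 0 < N := Nat.pos_of_ne_zero fun h => by rw [h] at hc; omega
  have hcdiv : (Fintype.card F - 1) / N = c := by rw [hc, Nat.mul_div_cancel_left _ hN0]
  have hNgcd : N * c = N * (N * c).gcd k := by
    refine (Nat.div_eq_iff_eq_mul_left (Nat.gcd_pos_of_pos_right _ hk0)
      (Nat.gcd_dvd_left _ _)).1 ?_
    rw [← hc, hN, hχk, orderOf_pow, hord]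
  have hgcd : (N * c).gcd k = c := (Nat.eq_of_mul_eq_mul_left hN0 hNgcd).symm
  obtain ⟨a, ha⟩ : c ∣ k := hgcd ▸ Nat.gcd_dvd_right (N * c) k
  have hc0 : 0 < c := Nat.pos_of_ne_zero fun h => by rw [h] at hc; omega
  rw [mul_comm] at ha
  have hbal := hdig a (by rw [hc, ha] at hk; exact lt_of_mul_lt_mul_right hk hc0.le) (by
    rw [ha, Nat.gcd_mul_right] at hgcd
    exact (Nat.Coprime.symm (Nat.eq_of_mul_eq_mul_right hc0 (by rw [one_mul]; exact hgcd))))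
  rw [hcdiv, ← ha] at hbal
  obtain ⟨u, v, hu, hv, h⟩ := exists_mul_gaussSum_inv_pow_eq ρ σ hω hψ1 hψ k hk
  obtain ⟨u', v', hu', hv', h'⟩ :=
    exists_mul_gaussSum_inv_pow_eq ρ σ hω hψ1 hψ (Fintype.card F - 1 - k) (by omega)
  rw [← hχk] at h
  rw [← hinv, ← hbal] at h'
  have hmem : v' * u ∈ I := (hI _).2 ⟨v * u', by
    linear_combination v' * h - v * h'⟩
  have h0 : ρ (v' * u) = 0 := Ideal.Quotient.eq_zero_iff_mem.2 (hIP hmem)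
  rw [map_mul] at h0
  exact (mul_ne_zero hv' hu) h0

end Unit

section Evaluation

variable {F : Type*} [Field F] [Fintype F]

theorem norm_gaussSum_sq {χ : MulChar F ℂ} (hχ : χ ≠ 1) {ψ : AddChar F ℂ} (hψ : ψ ≠ 1) :
    ‖gaussSum χ ψ‖ ^ 2 = Fintype.card F := by
  have h := gaussSum_mul_gaussSum_eq_card hχ (AddChar.IsPrimitive.of_ne_one hψ)
  rw [← star_gaussSum_eq, Complex.star_def, Complex.mul_conj, Complex.normSq_eq_norm_sq] at h
  exact_mod_cast h

/-- Kronecker's theorem applied to the quotient of a Gauss sum by `√q`. -/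
theorem exists_pow_eq_one_of_gaussSum_eq {χ : MulChar F AlgInt} (hχ : χ ≠ 1)
    {ψ : AddChar F AlgInt} (hψ : ψ ≠ 1) {c : ℕ} (hc : c ^ 2 = Fintype.card F) {η : AlgInt}
    (hη : gaussSum χ ψ = c * η) : ∃ m : ℕ, 0 < m ∧ η ^ m = 1 := by
  have hc0 : c ≠ 0 := by rintro rfl; exact Fintype.card_ne_zero (α := F) (by simpa using hc.symm)
  let S : Set ℂ := Set.range (fun x => (χ x : ℂ)) ∪ Set.range (fun x => (ψ x : ℂ))
  let L := IntermediateField.adjoin ℚ S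
  have hS : ∀ z ∈ S, IsIntegral ℚ z := by
    rintro z (⟨x, rfl⟩ | ⟨x, rfl⟩)
    · exact (χ x).2.tower_top
    · exact (ψ x).2.tower_top
  have : Finite S := Set.toFinite S
  have : FiniteDimensional ℚ L := IntermediateField.finiteDimensional_adjoin hS
  have : NumberField L := ⟨⟩
  have hχL : ∀ x, (χ x : ℂ) ∈ L := fun x => IntermediateField.subset_adjoin ℚ S (.inl ⟨x, rfl⟩)
  have hψL : ∀ x, (ψ x : ℂ) ∈ L := fun x => IntermediateField.subset_adjoin ℚ S (.inr ⟨x, rfl⟩)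
  let χL : MulChar F L :=
    { toFun := fun x => ⟨χ x, hχL x⟩
      map_one' := by ext; simp
      map_mul' := fun x y => by ext; simp
      map_nonunit' := fun x hx => by ext; simp [χ.map_nonunit hx] }
  let ψL : AddChar F L :=
    { toFun := fun x => ⟨ψ x, hψL x⟩
      map_zero_eq_one' := by ext; simp
      map_add_eq_mul' := fun x y => by ext; simp [AddChar.map_add_eq_mul] }
  have hχL1 : χL ≠ 1 := by
    obtain ⟨a, ha⟩ := MulChar.ne_one_iff.1 hχ
    refine MulChar.ne_one_iff.2 ⟨a, fun h => ha ?_⟩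
    exact Subtype.ext (congrArg (fun z : L => (z : ℂ)) h)
  have hψL1 : ψL ≠ 1 := by
    obtain ⟨a, ha⟩ := AddChar.ne_one_iff.1 hψ
    refine AddChar.ne_one_iff.2 ⟨a, fun h => ha ?_⟩
    exact Subtype.ext (congrArg (fun z : L => (z : ℂ)) h)
  have hG : ((gaussSum χL ψL : L) : ℂ) = c * (η : ℂ) := by
    have := congrArg (fun z : AlgInt => (z : ℂ)) hη
    simp only [gaussSum] at this
    push_cast at this
    rw [← this, gaussSum]
    push_cast
    rfl
  let y : L := gaussSum χL ψL / c
  have hy : (y : ℂ) = η := by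
    have : (c : ℂ) ≠ 0 := by exact_mod_cast hc0
    simp only [y]
    push_cast
    rw [hG]
    field_simp
  have hyint : IsIntegral ℤ y := by
    have h : IsIntegral ℤ (algebraMap L ℂ y) := by
      change IsIntegral ℤ (y : ℂ)
      rw [hy]; exact η.2
    exact (isIntegral_algebraMap_iff (algebraMap L ℂ).injective).1 h
  obtain ⟨m, hm, h⟩ := NumberField.Embeddings.pow_eq_one_of_norm_eq_one L ℂ hyint fun φ => by
    have h1 : φ (gaussSum χL ψL) =
        gaussSum (χL.ringHomComp φ) ((φ : L →* ℂ).compAddChar ψL) := by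
      simp [gaussSum]
    have h2 : ((φ : L →* ℂ).compAddChar ψL) ≠ 1 := by
      obtain ⟨a, ha⟩ := AddChar.ne_one_iff.1 hψL1
      refine AddChar.ne_one_iff.2 ⟨a, fun h => ha (φ.injective ?_)⟩
      simpa using h
    have h3 := norm_gaussSum_sq ((MulChar.ringHomComp_ne_one_iff φ.injective).2 hχL1) h2
    rw [← h1, ← hc, Nat.cast_pow] at h3
    have h4 := (pow_left_inj₀ (norm_nonneg _) (Nat.cast_nonneg _) two_ne_zero).1 h3
    rw [map_div₀, map_natCast, norm_div, h4, Complex.norm_natCast]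
    exact div_self (by exact_mod_cast hc0)
  refine ⟨m, hm, Subtype.ext ?_⟩
  have := congrArg (fun z : L => (z : ℂ)) h
  push_cast at this ⊢
  rwa [hy] at this

/-- The action of the Frobenius automorphism at `p` on a relation between roots of unity. -/
theorem gaussSum_pow_char_eq {p : ℕ} [hp : Fact p.Prime] [CharP F p] {χ : MulChar F AlgInt}
    {ψ : AddChar F AlgInt} {N m c : ℕ} (hN : χ ^ N = 1) (hNp : N.Coprime p) (hmp : m.Coprime p)
    {η : AlgInt} (hη : gaussSum χ ψ = c * η) (hm : η ^ m = 1) :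
    gaussSum (χ ^ p) ψ = c * η ^ p := by
  classical
  have hp0 : p ≠ 0 := hp.out.ne_zero
  have hDp : (N * m).Coprime p := Nat.Coprime.mul_left hNp hmp
  have hD0 : N * m ≠ 0 := fun h => by
    rw [h, Nat.coprime_zero_left] at hDp
    exact hp.out.one_lt.ne' hDp
  obtain ⟨a, haD, hap⟩ := Nat.chineseRemainder hDp p 1
  have hM0 : 0 < N * m * p := by positivity
  have haM : a.Coprime (N * m * p) := by
    refine Nat.Coprime.mul_right ?_ ?_
    · exact (haD.gcd_eq).trans hDp.symm
    · exact (hap.gcd_eq).trans (Nat.gcd_one_left _)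
  obtain ⟨ζ, hζ⟩ := exists_primitiveRoot hM0
  have : NeZero (N * m * p) := ⟨hM0.ne'⟩
  have hχD : ∀ x : Fˣ, χ x ^ N = 1 := fun x => by
    rw [← MulChar.pow_apply_coe, hN, MulChar.one_apply_coe]
  have hψp : ∀ x, ψ x ^ p = 1 := fun x => by
    rw [← AddChar.map_nsmul_eq_pow, nsmul_eq_mul, CharP.cast_eq_zero, zero_mul,
      AddChar.map_zero_eq_one]
  have hex : ∀ x : Fˣ, ∃ e, ζ ^ e = χ x * ψ x := fun x => by
    obtain ⟨e, -, he⟩ := hζ.eq_pow_of_pow_eq_one (ξ := χ x * ψ x) (by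
      rw [mul_pow, mul_assoc, pow_mul (χ x), hχD, one_pow, ← mul_assoc, mul_comm _ p,
        pow_mul (ψ x), hψp, one_pow, one_mul])
    exact ⟨e, he⟩
  choose e he using hex
  obtain ⟨j, -, hj⟩ := hζ.eq_pow_of_pow_eq_one (ξ := η) (by
    rw [mul_comm N m, mul_assoc, pow_mul, hm, one_pow])
  have hsum : ∀ φ : MulChar F AlgInt, gaussSum φ ψ = ∑ x : Fˣ, φ x * ψ x := fun φ =>
    sum_eq_sum_units (f := fun x => φ x * ψ x) (by simp only [MulChar.map_zero, zero_mul])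
  let f : Polynomial ℤ := ∑ x : Fˣ, Polynomial.X ^ e x - (c : Polynomial ℤ) * Polynomial.X ^ j
  have hf : ∀ z : AlgInt, Polynomial.aeval z f = ∑ x : Fˣ, z ^ e x - c * z ^ j := fun z => by
    simp [f]
  have h0 : Polynomial.aeval ζ f = 0 := by
    rw [hf, hj, ← hη, hsum, sub_eq_zero]
    exact sum_congr rfl fun x _ => he x
  have hdvd := minpoly.isIntegrallyClosed_dvd (hζ.isIntegral hM0) h0
  rw [hζ.minpoly_eq_pow_coprime haM] at hdvd
  have h1 : Polynomial.aeval (ζ ^ a) f = 0 := by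
    obtain ⟨g, hg⟩ := hdvd
    rw [hg, map_mul, minpoly.aeval, zero_mul]
  rw [hf, sub_eq_zero, ← pow_mul, mul_comm a, pow_mul, hj] at h1
  rw [hsum, ← pow_eq_pow_of_modEq (haD.of_dvd (Dvd.intro_left N rfl)) hm, ← h1]
  refine sum_congr rfl fun x _ => ?_
  rw [← pow_mul, mul_comm a, pow_mul, he, mul_pow, MulChar.pow_apply_coe,
    pow_eq_pow_of_modEq (haD.of_dvd (Dvd.intro m rfl)) (hχD x), pow_eq_pow_of_modEq hap (hψp x),
    pow_one]

theorem pow_pow_eq_one_of_map_eq_one {R K : Type*} [CommRing R] [IsDomain R] [Field K]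
    (ρ : R →+* K) {l : ℕ} [hl : Fact l.Prime] [CharP K l] {η : R} {m : ℕ} (hm0 : 0 < m)
    (hm : η ^ m = 1) (hρ : ρ η = 1) : ∃ t, η ^ l ^ t = 1 := by
  obtain ⟨t, n, hn, rfl⟩ := Nat.exists_eq_pow_mul_and_not_dvd hm0.ne' l hl.out.ne_one
  refine ⟨t, ?_⟩
  by_contra hne
  rw [pow_mul] at hm
  have h := geom_sum_mul (η ^ l ^ t) n
  rw [hm, sub_self, mul_eq_zero, sub_eq_zero, or_iff_left hne] at h
  have := congrArg ρ h
  rw [map_sum] at this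
  simp only [map_pow, hρ, one_pow, sum_const, card_range, nsmul_eq_mul, mul_one, map_zero] at this
  exact hn ((CharP.cast_eq_zero_iff K l n).1 this)

/-- A Gauss sum whose ideal is invariant under complex conjugation is equal to `√q` as soon as it
is congruent to `√q` modulo a prime above a suitable auxiliary prime number `l`. -/
theorem gaussSum_eq_of_map_eq {p : ℕ} [hp : Fact p.Prime] [CharP F p] {χ : MulChar F AlgInt}
    (hχ : χ ≠ 1) (hχm : χ (-1) = 1) {ψ : AddChar F AlgInt} (hψ1 : ψ ≠ 1)
    (hψ : ∀ x, ψ (x ^ p) = ψ x) {N : ℕ} (hN : χ ^ N = 1) (hNp : N.Coprime p)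
    (hdvd : gaussSum χ⁻¹ ψ ∣ gaussSum χ ψ) {c : ℕ} (hc : c ^ 2 = Fintype.card F)
    {K : Type*} [Field K] (ρ : AlgInt →+* K) {l : ℕ} [hl : Fact l.Prime] [CharP K l]
    (hlp : l.Coprime p) (hlp1 : l.Coprime (p - 1)) (hlc : (c : K) ≠ 0)
    (hρ : ρ (gaussSum χ ψ) = c) : gaussSum χ ψ = c := by
  have hprod : gaussSum χ ψ * gaussSum χ⁻¹ ψ = (c : AlgInt) ^ 2 := by
    rw [← Nat.cast_pow, hc, ← gaussSum_mul_gaussSum_eq_card hχ (AddChar.IsPrimitive.of_ne_one hψ1),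
      ← mul_gaussSum_inv_eq_gaussSum χ⁻¹ ψ, MulChar.inv_apply', inv_neg_one, hχm, one_mul]
  have hc0 : (c : ℂ) ≠ 0 := by
    rintro h
    rw [Nat.cast_eq_zero] at h
    exact Fintype.card_ne_zero (α := F) (by rw [← hc, h]; rfl)
  obtain ⟨ε, hε⟩ := hdvd
  have hsq : gaussSum χ ψ ^ 2 = (c : AlgInt) ^ 2 * ε := by
    rw [← hprod, mul_assoc, ← hε, sq]
  have hint : IsIntegral ℤ (((gaussSum χ ψ : AlgInt) : ℂ) / c) := by
    refine IsIntegral.of_pow two_pos ?_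
    have h := congrArg (fun z : AlgInt => (z : ℂ)) hsq
    push_cast at h
    rw [div_pow, h, mul_div_cancel_left₀ _ (pow_ne_zero 2 hc0)]
    exact ε.2
  let η : AlgInt := ⟨_, hint⟩
  have hη : gaussSum χ ψ = c * η := Subtype.ext (by
    push_cast
    exact (mul_div_cancel₀ _ hc0).symm)
  obtain ⟨m, hm0, hm⟩ := exists_pow_eq_one_of_gaussSum_eq hχ hψ1 hc hη
  have hρη : ρ η = 1 := by
    rw [hη, map_mul, map_natCast] at hρ
    exact mul_left_cancel₀ hlc (hρ.trans (mul_one _).symm)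
  obtain ⟨t, ht⟩ := pow_pow_eq_one_of_map_eq_one ρ (l := l) hm0 hm hρη
  have hfrob := gaussSum_pow_char_eq hN hNp (hlp.pow_left t) hη ht
  rw [gaussSum_pow_char χ hψ, hη] at hfrob
  have hcA : (c : AlgInt) ≠ 0 := by
    intro h
    exact hc0 (by exact_mod_cast congrArg (fun z : AlgInt => (z : ℂ)) h)
  have hη0 : η ≠ 0 := by
    intro h; rw [h, map_zero] at hρη; exact zero_ne_one hρη
  have hp1 : η ^ (p - 1) = 1 := by
    apply mul_left_cancel₀ hη0
    rw [← pow_succ', Nat.sub_add_cancel hp.out.pos, mul_one]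
    exact (mul_left_cancel₀ hcA hfrob).symm
  have h1 : orderOf η ∣ 1 := by
    rw [← (hlp1.pow_left t)]
    exact Nat.dvd_gcd (orderOf_dvd_of_pow_eq_one ht) (orderOf_dvd_of_pow_eq_one hp1)
  rw [hη, orderOf_eq_one_iff.1 (Nat.dvd_one.1 h1), mul_one]

theorem map_gaussSum_pow_eq {R K : Type*} [CommRing R] [Field K] (ρ : R →+* K) {l : ℕ}
    [hl : Fact l.Prime] [CharP K l] {χ : MulChar F R} {N b : ℕ} (hN : χ ^ N = 1)
    (hb : N ∣ l * b) (ψ : AddChar F R) :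
    ρ (gaussSum (χ ^ (b + 1)) ψ) = ρ (gaussSum χ ψ) := by
  simp only [gaussSum, map_sum, map_mul]
  refine sum_congr rfl fun x _ => ?_
  congr 1
  rcases eq_or_ne x 0 with rfl | hx
  · rw [MulChar.map_nonunit _ (by simp), MulChar.map_nonunit _ (by simp)]
  · obtain ⟨u, rfl⟩ := hx.isUnit
    have h1 : χ u ^ (b * l) = 1 := by
      obtain ⟨d, hd⟩ := hb
      rw [mul_comm, hd, ← MulChar.pow_apply_coe, pow_mul, hN, one_pow, MulChar.one_apply_coe]
    have h2 : ρ (χ u) ^ b = 1 := by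
      apply frobenius_inj K l
      rw [frobenius_def, frobenius_def, ← pow_mul, ← map_pow, h1, map_one, one_pow]
    rw [MulChar.pow_apply_coe, pow_succ, map_mul, map_pow, h2, one_mul]

theorem exists_ringHom_charP (l : ℕ) [hl : Fact l.Prime] :
    ∃ (K : Type) (_ : Field K) (_ : AlgInt →+* K), CharP K l := by
  have hnu : ¬ IsUnit (l : AlgInt) := by
    intro h
    obtain ⟨y, hy⟩ := h.exists_right_inv
    have hl0 : (l : ℂ) ≠ 0 := by exact_mod_cast hl.out.ne_zero
    have hy' : (y : ℂ) = algebraMap ℚ ℂ (l : ℚ)⁻¹ := by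
      have := congrArg (fun z : AlgInt => (z : ℂ)) hy
      push_cast at this
      rw [map_inv₀, map_natCast]
      exact eq_inv_of_mul_eq_one_right this
    have hint : IsIntegral ℤ ((l : ℚ)⁻¹) := by
      rw [← isIntegral_algebraMap_iff (algebraMap ℚ ℂ).injective, ← hy']
      exact y.2
    obtain ⟨n, hn⟩ := IsIntegrallyClosed.isIntegral_iff.1 hint
    have hlQ : (l : ℚ) ≠ 0 := by exact_mod_cast hl.out.ne_zero
    have h1 : (l : ℤ) * n = 1 := by
      have : (l : ℚ) * (n : ℚ) = 1 := by
        rw [show (n : ℚ) = (l : ℚ)⁻¹ from hn, mul_inv_cancel₀ hlQ]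
      exact_mod_cast this
    have h2 := Int.eq_one_or_neg_one_of_mul_eq_one h1
    have := hl.out.two_le
    omega
  obtain ⟨P, hP, hlP⟩ := exists_max_ideal_of_mem_nonunits hnu
  let := Ideal.Quotient.field P
  refine ⟨AlgInt ⧸ P, this, Ideal.Quotient.mk P, (CharP.charP_iff_prime_eq_zero hl.out).2 ?_⟩
  exact Ideal.Quotient.eq_zero_iff_mem.2 hlP

end Evaluation

section OrderTwoHundredThirtyOne

/-- The multiples of `(53³⁰ - 1) / N`, for `N = 3, 33, 231`, have balanced base-`53` digits. -/
theorem digits_sum_balanced : ∀ N ∈ [3, 33, 231], ∀ a < N, a.Coprime N →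
    (Nat.digits 53 (a * ((53 ^ 30 - 1) / N))).sum =
      (Nat.digits 53 (53 ^ 30 - 1 - a * ((53 ^ 30 - 1) / N))).sum := by
  decide +kernel

variable {F : Type*} [Field F] [Fintype F] [CharP F 53]

/-- One step of the descent on the order: removing the prime `l` from the order of `χ`. -/
theorem gaussSum_eq_of_pow (hcard : Fintype.card F = 53 ^ 30) {ψ : AddChar F AlgInt}
    (hψ1 : ψ ≠ 1) (hψ : ∀ x, ψ (x ^ 53) = ψ x) {χ : MulChar F AlgInt} {N l b : ℕ}
    (hχ : orderOf χ = N) (hN : N ∈ [3, 33, 231]) (hl : l ∈ [3, 7, 11]) (hb : N ∣ l * b)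
    (hred : ∀ {K : Type} [Field K] (ρ : AlgInt →+* K), CharP K l →
      ρ (gaussSum (χ ^ (b + 1)) ψ) = ((53 ^ 15 : ℕ) : K)) :
    gaussSum χ ψ = ((53 ^ 15 : ℕ) : AlgInt) := by
  have : Fact (Nat.Prime 53) := ⟨by norm_num⟩
  have hN' : Odd N ∧ N ≠ 1 ∧ N.Coprime 53 := by
    simp only [List.mem_cons, List.not_mem_nil, or_false] at hN
    rcases hN with rfl | rfl | rfl <;> decide
  have hl' : l.Prime ∧ l.Coprime 53 ∧ l.Coprime (53 - 1) := by
    simp only [List.mem_cons, List.not_mem_nil, or_false] at hl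
    rcases hl with rfl | rfl | rfl <;> norm_num
  obtain ⟨hodd, hN1, hNp⟩ := hN'
  obtain ⟨hlprime, hlp, hlp1⟩ := hl'
  have : Fact l.Prime := ⟨hlprime⟩
  have hχN : χ ^ N = 1 := hχ ▸ pow_orderOf_eq_one χ
  have hχ1 : χ ≠ 1 := by
    rintro rfl
    exact hN1 (by rw [← hχ, orderOf_one])
  have hχm : χ (-1) = 1 := MulChar.val_neg_one_eq_one_of_odd_order hodd hχN
  obtain ⟨K, _, ρ, hK⟩ := exists_ringHom_charP l
  refine gaussSum_eq_of_map_eq hχ1 hχm hψ1 hψ hχN hNp ?_ (by rw [hcard]; norm_num) ρ hlp hlp1 ?_ ?_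
  · refine gaussSum_inv_dvd_gaussSum hψ1 hψ hχ1 hχm ?_
    rw [hχ, hcard]
    exact digits_sum_balanced N hN
  · rw [Ne, CharP.cast_eq_zero_iff K l]
    intro h
    exact hlprime.one_lt.ne' (Nat.Coprime.eq_one_of_dvd (hlp.pow_right 15) h)
  · rw [← map_gaussSum_pow_eq ρ hχN hb, hred ρ hK]

theorem gaussSum_eq_of_orderOf_eq (hcard : Fintype.card F = 53 ^ 30) {ψ : AddChar F AlgInt}
    (hψ1 : ψ ≠ 1) (hψ : ∀ x, ψ (x ^ 53) = ψ x) {χ : MulChar F AlgInt} (hχ : orderOf χ = 231) :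
    gaussSum χ ψ = ((53 ^ 15 : ℕ) : AlgInt) := by
  have h33 : orderOf (χ ^ (132 + 1)) = 33 := by rw [orderOf_pow, hχ]; norm_num
  have h3 : orderOf ((χ ^ (132 + 1)) ^ (21 + 1)) = 3 := by rw [orderOf_pow, h33]; norm_num
  refine gaussSum_eq_of_pow hcard hψ1 hψ hχ (l := 7) (b := 132) (by simp) (by simp) (by norm_num)
    fun ρ _ => ?_
  rw [gaussSum_eq_of_pow hcard hψ1 hψ h33 (l := 11) (b := 21) (by simp) (by simp) (by norm_num)
    fun ρ _ => ?_, map_natCast]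
  rw [gaussSum_eq_of_pow hcard hψ1 hψ h3 (l := 3) (b := 2) (by simp) (by simp) (by norm_num)
    fun ρ h => ?_, map_natCast]
  have h1 : ((χ ^ (132 + 1)) ^ (21 + 1)) ^ (2 + 1) = 1 := by
    have := pow_orderOf_eq_one ((χ ^ (132 + 1)) ^ (21 + 1))
    rwa [h3] at this
  rw [h1, gaussSum_one_left hψ1, map_neg, map_one, eq_comm, eq_neg_iff_add_eq_zero]
  exact_mod_cast (CharP.cast_eq_zero_iff _ 3 (53 ^ 15 + 1)).2 (by norm_num)

end OrderTwoHundredThirtyOne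

section TraceCharacter

variable {F : Type*} [Field F] [Fintype F] {p : ℕ} [hp : Fact p.Prime] [Algebra (ZMod p) F]

theorem exists_traceChar : ∃ ψ : AddChar F AlgInt, ψ ≠ 1 ∧ (∀ x, ψ (x ^ p) = ψ x) ∧
    ∀ x, (ψ x : ℂ) = Complex.exp (2 * (Real.pi : ℂ) * Complex.I *
      ((Algebra.trace (ZMod p) F x).val : ℂ) / p) := by
  have hp0 : p ≠ 0 := hp.out.ne_zero
  have hexp := Complex.isPrimitiveRoot_exp p hp0
  let ζ : AlgInt := ⟨_, hexp.isIntegral hp.out.pos⟩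
  have hζ : IsPrimitiveRoot ζ p :=
    IsPrimitiveRoot.of_map_of_injective (f := algebraMap AlgInt ℂ) hexp Subtype.val_injective
  refine ⟨(AddChar.zmodChar p hζ.pow_eq_one).compAddMonoidHom
    (Algebra.trace (ZMod p) F).toAddMonoidHom, ?_, fun x => ?_, fun x => ?_⟩
  · obtain ⟨x, hx⟩ := Algebra.trace_surjective (ZMod p) F 1
    refine AddChar.ne_one_iff.2 ⟨x, ?_⟩
    have : Fact (1 < p) := ⟨hp.out.one_lt⟩
    simpa [hx, AddChar.zmodChar_apply, ZMod.val_one] using hζ.ne_one hp.out.one_lt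
  · have h := Algebra.trace_eq_of_algEquiv (FiniteField.frobeniusAlgEquivOfAlgebraic (ZMod p) F) x
    rw [FiniteField.coe_frobeniusAlgEquivOfAlgebraic] at h
    simp only [ZMod.card] at h
    simp [h]
  · simp only [AddChar.compAddMonoidHom_apply, AddChar.zmodChar_apply, SubmonoidClass.coe_pow, ζ,
      ← Complex.exp_nat_mul]
    congr 1
    simp only [LinearMap.toAddMonoidHom_coe]
    ring

theorem exists_ringHomComp_eq (χ : MulChar F ℂ) :
    ∃ χ' : MulChar F AlgInt, χ'.ringHomComp (algebraMap AlgInt ℂ) = χ := by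
  have hint : ∀ x, IsIntegral ℤ (χ x) := fun x => by
    rcases eq_or_ne x 0 with rfl | hx
    · rw [MulChar.map_nonunit _ (by simp)]; exact isIntegral_zero
    · have hpos : 0 < Fintype.card F - 1 := Nat.sub_pos_of_lt Fintype.one_lt_card
      refine IsIntegral.of_pow hpos ?_
      rw [← map_pow, FiniteField.pow_card_sub_one_eq_one x hx, map_one]
      exact isIntegral_one
  exact ⟨{ toFun := fun x => ⟨χ x, hint x⟩
           map_one' := by ext; simp
           map_mul' := fun x y => by ext; simp
           map_nonunit' := fun x hx => by ext; simp [χ.map_nonunit hx] }, by ext; rfl⟩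

end TraceCharacter

end StickelbergerUnit

/-- **Evaluation of Gauss sums of order 231 over `F_{53³⁰}`.**
For every multiplicative character `χ` of order `231` of the finite field `F` with
`53³⁰` elements, the Gauss sum `G(χ) = ∑ x, χ x · exp(2πi·T(x)/53)` equals `53¹⁵`. -/
theorem gauss_sum_order_231_card_53_pow_30
    (F : Type) [Field F] [Fintype F] [Algebra (ZMod 53) F]
    (hcard : Fintype.card F = 53 ^ 30)
    (χ : MulChar F ℂ) (hχ : orderOf χ = 231) :
    (∑ x : F, χ x * Complex.exp (2 * (Real.pi : ℂ) * Complex.I *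
        ((Algebra.trace (ZMod 53) F x).val : ℂ) / 53)) = (53 : ℂ) ^ 15 := by
  have : Fact (Nat.Prime 53) := ⟨by norm_num⟩
  have : CharP F 53 := charP_of_injective_algebraMap (algebraMap (ZMod 53) F).injective 53
  obtain ⟨ψ, hψ1, hψ, hψexp⟩ := StickelbergerUnit.exists_traceChar (F := F) (p := 53)
  obtain ⟨χ', rfl⟩ := StickelbergerUnit.exists_ringHomComp_eq χ
  have hord : orderOf χ' = 231 := by
    rw [← hχ]
    exact (orderOf_injective (MulChar.ringHomCompHom (algebraMap StickelbergerUnit.AlgInt ℂ))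
      (MulChar.injective_ringHomComp Subtype.val_injective) χ').symm
  have h := congrArg (algebraMap StickelbergerUnit.AlgInt ℂ)
    (StickelbergerUnit.gaussSum_eq_of_orderOf_eq hcard hψ1 hψ hord)
  rw [gaussSum, map_sum, map_natCast, Nat.cast_pow, Nat.cast_ofNat] at h
  rw [← h]
  refine Finset.sum_congr rfl fun x _ => ?_
  rw [map_mul]
  congr 1
  exact_mod_cast (hψexp x).symm
end

section
/- For every multiplicative character χ of order 231 of the finite field F_q with q = 101^30, the Gauss sum G(χ) = Σ_{x ∈ F_q} χ(x) ψ(x) ∈ ℂ equals 101^15. (This is the pure Gauss sum case: 101^15 ≡ −1 (mod 231), i.e. −1 ∈ ⟨101⟩ ⊂ (ℤ/231ℤ)^*.) -/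
/-- A sum over a finite field splits into the value at zero and the sum over the units. -/
theorem Fintype.sum_eq_zero_add_sum_units {K M : Type*} [Field K] [Fintype K] [DecidableEq K]
    [AddCommMonoid M] (f : K → M) : ∑ k, f k = f 0 + ∑ u : Kˣ, f u := by
  rw [Fintype.sum_eq_add_sum_subtype_ne f 0,
    ← Fintype.sum_equiv unitsEquivNeZero (fun u : Kˣ ↦ f u) (fun k ↦ f k) (fun _ ↦ rfl)]

/-- The sum of `ψ (k * x)` over a subfield `K` of half degree in `F`, when `ψ` is trivial on the
line `K * x₀`, detects whether `x` lies on that line. -/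
theorem AddChar.sum_algebraMap_mul_eq_ite {K F R : Type*} [Field K] [Fintype K] [Field F]
    [Fintype F] [Algebra K F] [CommRing R] [IsDomain R]
    (hcard : Fintype.card F = Fintype.card K ^ 2) {ψ : AddChar F R} (hψ : ψ ≠ 1) {x₀ : F}
    (hx₀ : x₀ ≠ 0) (hψx₀ : ∀ k : K, ψ (algebraMap K F k * x₀) = 1) (x : F)
    [Decidable (∃ a : K, algebraMap K F a * x₀ = x)] :
    ∑ k : K, ψ (algebraMap K F k * x) =
      if ∃ a : K, algebraMap K F a * x₀ = x then (Fintype.card K : R) else 0 := by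
  split_ifs with h
  · obtain ⟨a, rfl⟩ := h
    simp [← mul_assoc, ← map_mul, hψx₀]
  · let φ : AddChar K R := ψ.compAddMonoidHom
      ((AddMonoidHom.mulRight x).comp (algebraMap K F).toAddMonoidHom)
    suffices hφ : φ ≠ 1 from AddChar.sum_eq_zero_of_ne_one hφ
    intro hφ
    have hψx (k : K) : ψ (algebraMap K F k * x) = 1 := DFunLike.congr_fun hφ k
    let f : K × K →+ F := AddMonoidHom.coprod
      ((AddMonoidHom.mulRight x₀).comp (algebraMap K F).toAddMonoidHom)
      ((AddMonoidHom.mulRight x).comp (algebraMap K F).toAddMonoidHom)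
    have hf (a b : K) : f (a, b) = algebraMap K F a * x₀ + algebraMap K F b * x := rfl
    have hinj : Function.Injective f := by
      rw [injective_iff_map_eq_zero]
      rintro ⟨a, b⟩ hab
      rw [hf] at hab
      have hb : b = 0 := by
        by_contra hb
        refine h ⟨-a / b, ?_⟩
        have hb' : algebraMap K F b ≠ 0 := by simpa using hb
        rw [map_div₀, map_neg]
        field_simp
        linear_combination -hab
      subst hb
      simpa [hx₀] using hab
    have hsurj : Function.Surjective f :=
      ((Fintype.bijective_iff_injective_and_card f).2
        ⟨hinj, by rw [Fintype.card_prod, hcard, sq]⟩).2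
    refine hψ (DFunLike.ext _ _ fun y ↦ ?_)
    obtain ⟨⟨a, b⟩, rfl⟩ := hsurj y
    rw [hf, AddChar.map_add_eq_mul, hψx₀, hψx, mul_one, AddChar.one_apply]

/-- **Stickelberger's evaluation** of the Gauss sum of a nontrivial multiplicative character of `F`
that is trivial on a subfield of half degree. -/
theorem gaussSum_eq_card_mul_of_trivial_on_subfield {K F R : Type*} [Field K] [Fintype K]
    [Field F] [Fintype F] [Algebra K F] [CommRing R] [IsDomain R] [CharZero R]
    (hcard : Fintype.card F = Fintype.card K ^ 2) {χ : MulChar F R} (hχ : χ ≠ 1)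
    (hχK : ∀ k : K, k ≠ 0 → χ (algebraMap K F k) = 1) {ψ : AddChar F R} (hψ : ψ ≠ 1) {x₀ : F}
    (hx₀ : x₀ ≠ 0) (hψx₀ : ∀ k : K, ψ (algebraMap K F k * x₀) = 1) :
    gaussSum χ ψ = Fintype.card K * χ x₀ := by
  classical
  have hunits : (Fintype.card Kˣ : R) ≠ 0 := by simp [Fintype.card_ne_zero]
  refine mul_left_cancel₀ hunits ?_
  have key (x : F) : ∑ u : Kˣ, ψ (algebraMap K F u * x) =
      (if ∃ a : K, algebraMap K F a * x₀ = x then (Fintype.card K : R) else 0) - 1 := by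
    rw [← AddChar.sum_algebraMap_mul_eq_ite hcard hψ hx₀ hψx₀ x,
      Fintype.sum_eq_zero_add_sum_units (K := K)]
    simp
  calc (Fintype.card Kˣ : R) * gaussSum χ ψ
      = ∑ u : Kˣ, ∑ x : F, χ x * ψ (algebraMap K F u * x) := by
        rw [← nsmul_eq_mul, ← Finset.card_univ, ← Finset.sum_const]
        refine Finset.sum_congr rfl fun u _ ↦ ?_
        rw [← gaussSum_mulShift χ ψ (Units.map (algebraMap K F).toMonoidHom u)]
        simp [gaussSum, hχK]
    _ = ∑ x : F, χ x * ((if ∃ a : K, algebraMap K F a * x₀ = x then (Fintype.card K : R) else 0)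
          - 1) := by
        rw [Finset.sum_comm]
        simp_rw [← Finset.mul_sum, key]
    _ = ∑ x : F with ∃ a : K, algebraMap K F a * x₀ = x, χ x * Fintype.card K := by
        simp_rw [mul_sub, mul_one, Finset.sum_sub_distrib, MulChar.sum_eq_zero_of_ne_one hχ,
          sub_zero, mul_ite, mul_zero, Finset.sum_filter]
    _ = ∑ a : K, χ (algebraMap K F a * x₀) * Fintype.card K := by
        have himage : ({x : F | ∃ a : K, algebraMap K F a * x₀ = x} : Finset F) =
            Finset.univ.image fun a : K ↦ algebraMap K F a * x₀ := by ext; simp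
        rw [himage, Finset.sum_image]
        exact ((mul_left_injective₀ hx₀).comp (algebraMap K F).injective).injOn
    _ = ∑ u : Kˣ, χ x₀ * Fintype.card K := by
        rw [Fintype.sum_eq_zero_add_sum_units]
        simp [hχK, MulChar.map_zero]
    _ = Fintype.card Kˣ * (Fintype.card K * χ x₀) := by
        rw [Finset.sum_const, Finset.card_univ, nsmul_eq_mul, mul_comm (χ x₀)]

/-- A pure Gauss sum: if the order of `χ` divides `(#K + 1) / 2`, where `F` is a quadratic
extension of `K` of odd characteristic, and `ψ` is invariant under the Frobenius of `F` over `K`,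
then the Gauss sum is `#K`. -/
theorem gaussSum_eq_card_of_orderOf_dvd {K F R : Type*} [Field K] [Fintype K]
    [Field F] [Fintype F] [Algebra K F] [CommRing R] [IsDomain R] [CharZero R]
    (hcard : Fintype.card F = Fintype.card K ^ 2) (hchar : ringChar F ≠ 2)
    {χ : MulChar F R} (hχ : χ ≠ 1) (hdvd : 2 * orderOf χ ∣ Fintype.card K + 1)
    {ψ : AddChar F R} (hψ : ψ ≠ 1) (hψK : ∀ x, ψ (x ^ Fintype.card K) = ψ x) :
    gaussSum χ ψ = Fintype.card K := by
  obtain ⟨c, hc⟩ := hdvd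
  have hpow (y : F) (hy : y ≠ 0) (m : ℕ) : χ (y ^ (orderOf χ * m)) = 1 := by
    rw [map_pow, pow_mul, ← MulChar.pow_apply' _ (orderOf_pos χ).ne', pow_orderOf_eq_one,
      MulChar.one_apply hy.isUnit, one_pow]
  have hK : 1 < Fintype.card K := Fintype.one_lt_card
  have hexp : (Fintype.card F - 1) / (Fintype.card K - 1) = Fintype.card K + 1 := by
    rw [hcard, ← one_pow 2, Nat.sq_sub_sq, one_pow, Nat.mul_div_cancel _ (by lia)]
  have hχK (k : K) (hk : k ≠ 0) : χ (algebraMap K F k) = 1 := by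
    obtain ⟨u, hu⟩ := FiniteField.unitsMap_norm_surjective K F (Units.mk0 k hk)
    have hk' : k = Algebra.norm K (u : F) := congrArg Units.val hu.symm
    rw [hk', FiniteField.algebraMap_norm_eq_pow, Nat.card_eq_fintype_card,
      Nat.card_eq_fintype_card, hexp, hc, mul_comm 2, mul_assoc]
    exact hpow _ u.ne_zero _
  obtain ⟨g, hg⟩ := IsCyclic.exists_ofOrder_eq_natCard (α := Fˣ)
  rw [Nat.card_units, Nat.card_eq_fintype_card, hcard] at hg
  obtain ⟨x₀, hx₀⟩ : ∃ x₀ : Fˣ, x₀ = g ^ (orderOf χ * c) := ⟨_, rfl⟩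
  have hχx₀ : χ x₀ = 1 := by rw [hx₀, Units.val_pow_eq_pow_val]; exact hpow _ g.ne_zero _
  have hsq : (x₀ ^ (Fintype.card K - 1)) ^ 2 = 1 := by
    rw [hx₀, ← pow_mul, ← pow_mul, ← orderOf_dvd_iff_pow_eq_one, hg, ← one_pow 2, Nat.sq_sub_sq,
      one_pow, hc]
    exact dvd_of_eq (by ring)
  have hne : x₀ ^ (Fintype.card K - 1) ≠ 1 := by
    rw [hx₀, ← pow_mul, Ne, ← orderOf_dvd_iff_pow_eq_one, hg, ← one_pow 2, Nat.sq_sub_sq,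
      one_pow, hc, Nat.mul_dvd_mul_iff_right (by lia), mul_assoc]
    intro h
    have := Nat.le_of_dvd (by lia) h
    lia
  have hneg : (x₀ : F) ^ (Fintype.card K - 1) = -1 := by
    rw [← Units.val_inj] at hsq
    rw [Ne, ← Units.val_inj] at hne
    push_cast at hsq hne
    exact (sq_eq_one_iff.1 hsq).resolve_left hne
  have hx₀pow : (x₀ : F) ^ Fintype.card K = -x₀ := by
    rw [← Nat.sub_add_cancel hK.le, pow_succ, hneg, neg_one_mul]
  have h2 : (2 : F) ≠ 0 := Ring.two_ne_zero hchar
  have hψx₀ (k : K) : ψ (algebraMap K F k * x₀) = 1 := by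
    have h := hψK (algebraMap K F (k / 2) * x₀)
    rw [mul_pow, ← map_pow, FiniteField.pow_card, hx₀pow] at h
    have hsplit : algebraMap K F k * x₀ =
        algebraMap K F (k / 2) * x₀ + algebraMap K F (k / 2) * x₀ := by
      rw [map_div₀, map_ofNat]
      field_simp
      ring
    rw [hsplit, AddChar.map_add_eq_mul]
    nth_rw 1 [← h]
    rw [← AddChar.map_add_eq_mul, mul_neg, neg_add_cancel, AddChar.map_zero_eq_one]
  rw [gaussSum_eq_card_mul_of_trivial_on_subfield hcard hχ hχK hψ x₀.ne_zero hψx₀, hχx₀, mul_one]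

/-- **Evaluation of Gauss sums of order 231 over `F_{101³⁰}` (the pure Gauss sum case).**
For every multiplicative character `χ` of order `231` of the finite field `F` with
`101³⁰` elements, the Gauss sum `G(χ) = ∑ x, χ x · exp(2πi·T(x)/101)` equals `101¹⁵`.
Moreover `101¹⁵ ≡ −1 (mod 231)`, i.e. `−1 ∈ ⟨101⟩ ⊆ (ℤ/231ℤ)ˣ`. -/
theorem gauss_sum_order_231_card_101_pow_30
    (F : Type) [Field F] [Fintype F] [Algebra (ZMod 101) F]
    (hcard : Fintype.card F = 101 ^ 30)
    (χ : MulChar F ℂ) (hχ : orderOf χ = 231) :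
    (∑ x : F, χ x * Complex.exp (2 * (Real.pi : ℂ) * Complex.I *
        ((Algebra.trace (ZMod 101) F x).val : ℂ) / 101)) = (101 : ℂ) ^ 15 ∧
    ((101 : ZMod 231) ^ 15 = -1) := by
  refine ⟨?_, by decide⟩
  have : Fact (Nat.Prime 101) := ⟨by norm_num⟩
  have : CharP F 101 := charP_of_injective_algebraMap (algebraMap (ZMod 101) F).injective 101
  have hfinrank : Module.finrank (ZMod 101) F = 30 := by
    have h := Module.card_eq_pow_finrank (K := ZMod 101) (V := F)
    rw [hcard, ZMod.card] at h
    exact (Nat.pow_right_injective (by norm_num : 2 ≤ 101) h).symm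
  obtain ⟨f⟩ := FiniteField.nonempty_algHom_of_finrank_dvd (F := ZMod 101)
    (K := GaloisField 101 15) (L := F)
    (by rw [hfinrank, GaloisField.finrank 101 (by norm_num)]; norm_num)
  let : Algebra (GaloisField 101 15) F := f.toRingHom.toAlgebra
  let : Fintype (GaloisField 101 15) := Fintype.ofFinite _
  have hK : Fintype.card (GaloisField 101 15) = 101 ^ 15 := by
    rw [← Nat.card_eq_fintype_card, GaloisField.card 101 15 (by norm_num)]
  let ψ : AddChar F ℂ :=
    (ZMod.stdAddChar (N := 101)).compAddMonoidHom (Algebra.trace (ZMod 101) F).toAddMonoidHom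
  have hψ_apply (x : F) : ψ x = ZMod.stdAddChar (Algebra.trace (ZMod 101) F x) := rfl
  have hψ : ψ ≠ 1 := by
    intro h
    obtain ⟨x, hx⟩ := Algebra.trace_surjective (ZMod 101) F 1
    have h1 := DFunLike.congr_fun h x
    rw [hψ_apply, hx, AddChar.one_apply, ← AddChar.map_zero_eq_one (ZMod.stdAddChar (N := 101))]
      at h1
    exact one_ne_zero (ZMod.injective_stdAddChar h1)
  have hψK (x : F) : ψ (x ^ Fintype.card (GaloisField 101 15)) = ψ x := by
    have h := Algebra.trace_eq_of_algEquiv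
      (FiniteField.frobeniusAlgEquivOfAlgebraic (ZMod 101) F ^ 15) x
    rw [AlgEquiv.coe_pow, FiniteField.coe_frobeniusAlgEquivOfAlgebraic_iterate, ZMod.card] at h
    rw [hK, hψ_apply, hψ_apply, h]
  have hmain := gaussSum_eq_card_of_orderOf_dvd (K := GaloisField 101 15) (χ := χ)
    (by rw [hcard, hK, ← pow_mul]) (by rw [ringChar.eq F 101]; norm_num)
    (by rintro rfl; simp at hχ) (by rw [hχ, hK]; norm_num) hψ hψK
  rw [hK, Nat.cast_pow, Nat.cast_ofNat] at hmain
  rw [← hmain]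
  refine Finset.sum_congr rfl fun x _ ↦ ?_
  rw [hψ_apply, ZMod.stdAddChar_apply, ZMod.toCircle_apply]
  norm_num
end
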